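/- arXiv:math/0502354 — 2 statements merged into one kernel-verified Lean document; each statement's English description precedes it below -/
import Mathlib

section
/- With β^N as defined, for every positive integer N and every index i with 1 ≤ i < n+m, one has |log( log(1/α_i(β^N)) / log(1/α_i(β^{N+1})) )| < 2^{i−(n+m)+1}. -/
open scoped Real ENNReal
open Filter

/-- The Gauss-map iterates: `alphaIter θ k` is `α_{k+1}(θ)`, i.e. `alphaIter θ 0 = α_1(θ) = θ`
and `α_{i+1}(θ)` is the fractional part of `1/α_i(θ)`. -/
noncomputable def alphaIter (θ : ℝ) : ℕ → ℝ
  | 0 => θ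
  | k + 1 => Int.fract (1 / alphaIter θ k)

/-- `HasCF θ a` : `θ` is an irrational number in `(0,1)` whose continued fraction digits
are given by `a` (0-indexed: `a k` is the digit `a_{k+1}` in 1-indexed notation). -/
def HasCF (θ : ℝ) (a : ℕ → ℕ) : Prop :=
  θ ∈ Set.Ioo (0 : ℝ) 1 ∧ Irrational θ ∧ ∀ k, ⌊1 / alphaIter θ k⌋ = (a k : ℤ)

/-- Yoccoz's Brjuno function `Φ(θ) = Σ_{n≥1} α_1(θ)⋯α_{n-1}(θ)·log(1/α_n(θ))`,
as a real-valued sum. -/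
noncomputable def brjunoPhi (θ : ℝ) : ℝ :=
  ∑' k : ℕ, (∏ j ∈ Finset.range k, alphaIter θ j) * Real.log (1 / alphaIter θ k)

/-- Yoccoz's Brjuno function with values in `ℝ≥0∞` (all terms are nonnegative). -/
noncomputable def brjunoPhiE (θ : ℝ) : ℝ≥0∞ :=
  ∑' k : ℕ, ENNReal.ofReal ((∏ j ∈ Finset.range k, alphaIter θ j) * Real.log (1 / alphaIter θ k))

/-- Digits of the noble number `ω = [a_1,…,a_n,1,1,1,…]`. -/
def nobleDigits (n : ℕ) (a : ℕ → ℕ) : ℕ → ℕ := fun k => if k < n then a k else 1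

/-- Digits of `β^N = [a_1,…,a_n,1,…,1,N,1,1,…]`, with `N` in (1-indexed) position `n+m`. -/
def betaDigits (n m N : ℕ) (a : ℕ → ℕ) : ℕ → ℕ :=
  fun k => if k + 1 = n + m then N else if k < n then a k else 1

/-- Digits of `β^I = [a_1,…,a_n,1,…,1,b_{n+m},b_{n+m+1},…]`: the digits of the noble number
with the whole tail from (1-indexed) position `n+m` on replaced by the tail `b`. -/
def tailDigits (n m : ℕ) (a b : ℕ → ℕ) : ℕ → ℕ :=
  fun k => if k + 1 < n + m then (if k < n then a k else 1) else b k

lemma HasCF.irrational_alphaIter {θ : ℝ} {d : ℕ → ℕ} (h : HasCF θ d) (k : ℕ) :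
    Irrational (alphaIter θ k) := by
  induction k with
  | zero => exact h.2.1
  | succ k ih =>
    have : Irrational (1 / alphaIter θ k) := by
      rw [one_div]
      exact irrational_inv_iff.2 ih
    exact this.sub_intCast _

lemma HasCF.alphaIter_mem_Ioo {θ : ℝ} {d : ℕ → ℕ} (h : HasCF θ d) (k : ℕ) :
    alphaIter θ k ∈ Set.Ioo (0 : ℝ) 1 := by
  cases k with
  | zero => exact h.1
  | succ k =>
    exact ⟨lt_of_le_of_ne (Int.fract_nonneg _) (h.irrational_alphaIter (k + 1)).ne_zero.symm,
      Int.fract_lt_one _⟩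

lemma HasCF.one_div_alphaIter {θ : ℝ} {d : ℕ → ℕ} (h : HasCF θ d) (k : ℕ) :
    1 / alphaIter θ k = d k + alphaIter θ (k + 1) := by
  have h1 := Int.floor_add_fract (1 / alphaIter θ k)
  rw [h.2.2 k] at h1
  exact_mod_cast h1.symm

lemma HasCF.log_alphaIter {θ : ℝ} {d : ℕ → ℕ} (h : HasCF θ d) (k : ℕ) :
    Real.log (alphaIter θ k) = -Real.log (d k + alphaIter θ (k + 1)) := by
  rw [← h.one_div_alphaIter k, one_div, Real.log_inv, neg_neg]

/-- Adding `c ≥ 1` halves logarithmic distances on `(0,1)`. -/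
lemma abs_log_add_sub_log_add_le {c s t : ℝ} (hc : 1 ≤ c) (hs : s ∈ Set.Ioo (0 : ℝ) 1)
    (ht : t ∈ Set.Ioo (0 : ℝ) 1) :
    |Real.log (c + s) - Real.log (c + t)| ≤ |Real.log s - Real.log t| / 2 := by
  wlog hts : t ≤ s generalizing s t
  · rw [abs_sub_comm, abs_sub_comm (Real.log s)]
    exact this ht hs (le_of_not_ge hts)
  obtain ⟨hs0, hs1⟩ := hs
  obtain ⟨ht0, ht1⟩ := ht
  rw [abs_of_nonneg (sub_nonneg.2 (Real.log_le_log (by linarith) (by linarith))),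
    abs_of_nonneg (sub_nonneg.2 (Real.log_le_log ht0 hts))]
  have key : t * (c + s) ^ 2 ≤ s * (c + t) ^ 2 := by
    have : 0 ≤ (s - t) * (c ^ 2 - s * t) :=
      mul_nonneg (by linarith) (by nlinarith)
    nlinarith
  have hcs : 0 < c + s := by linarith
  have hct : 0 < c + t := by linarith
  have := Real.log_le_log (by positivity) key
  rw [Real.log_mul (by positivity) (by positivity), Real.log_mul (by positivity) (by positivity),
    Real.log_pow, Real.log_pow] at this
  push_cast at this
  linarith

/-- The map `x ↦ log (log (c + x))`, with `c ≥ 1`, does not increase logarithmic distances. -/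
lemma abs_log_div_log_add_le {c s t : ℝ} (hc : 1 ≤ c) (hs : 0 < s) (ht : 0 < t) :
    |Real.log (Real.log (c + s) / Real.log (c + t))| ≤ |Real.log s - Real.log t| := by
  have hls : 0 < Real.log (c + s) := Real.log_pos (by linarith)
  have hlt : 0 < Real.log (c + t) := Real.log_pos (by linarith)
  rw [Real.log_div hls.ne' hlt.ne']
  wlog hts : t ≤ s generalizing s t
  · rw [abs_sub_comm, abs_sub_comm (Real.log s)]
    exact this ht hs hlt hls (le_of_not_ge hts)
  rw [abs_of_nonneg (sub_nonneg.2 (Real.log_le_log hlt (Real.log_le_log (by linarith)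
    (by linarith)))), abs_of_nonneg (sub_nonneg.2 (Real.log_le_log ht hts))]
  have hconc := strictConcaveOn_log_Ioi.concaveOn.2 (Set.mem_Ioi.2 (by linarith : 0 < c + s))
    (Set.mem_Ioi.2 (by linarith : 0 < c)) (by positivity : 0 ≤ t / s)
    (sub_nonneg.2 ((div_le_one hs).2 hts)) (by ring)
  have hcomb : (t / s) • (c + s) + (1 - t / s) • c = c + t := by
    simp only [smul_eq_mul]
    field_simp
    ring
  rw [hcomb] at hconc
  simp only [smul_eq_mul] at hconc
  have hrest : 0 ≤ (1 - t / s) * Real.log c :=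
    mul_nonneg (sub_nonneg.2 ((div_le_one hs).2 hts)) (Real.log_nonneg hc)
  have key : t * Real.log (c + s) ≤ s * Real.log (c + t) := by
    have h1 : t / s * Real.log (c + s) ≤ Real.log (c + t) := by linarith
    rw [div_mul_eq_mul_div, div_le_iff₀ hs] at h1
    linarith
  have := Real.log_le_log (by positivity) key
  rw [Real.log_mul ht.ne' hls.ne', Real.log_mul hs.ne' hlt.ne'] at this
  linarith

/-- If two digit sequences agree and are positive on `[k, k + j)`, the logarithmic distance of the
Gauss iterates at `k` is at most `2⁻ʲ` times the distance at `k + j`. -/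
lemma HasCF.abs_log_alphaIter_sub_le {x y : ℝ} {d e : ℕ → ℕ} (hx : HasCF x d) (hy : HasCF y e)
    (k j : ℕ) (hde : ∀ l, k ≤ l → l < k + j → 0 < d l ∧ d l = e l) :
    |Real.log (alphaIter x k) - Real.log (alphaIter y k)| ≤
      |Real.log (alphaIter x (k + j)) - Real.log (alphaIter y (k + j))| / 2 ^ j := by
  induction j with
  | zero => simp
  | succ j ih =>
    obtain ⟨hpos, heq⟩ := hde (k + j) (by omega) (by omega)
    have hstep := abs_log_add_sub_log_add_le (c := d (k + j)) (by exact_mod_cast hpos)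
      (hx.alphaIter_mem_Ioo (k + j + 1)) (hy.alphaIter_mem_Ioo (k + j + 1))
    refine (ih fun l h1 h2 => hde l h1 (by omega)).trans ?_
    rw [hx.log_alphaIter (k + j), hy.log_alphaIter (k + j), ← heq, neg_sub_neg, abs_sub_comm,
      pow_succ', ← div_div]
    exact div_le_div_of_nonneg_right hstep (by positivity)

/-- If the digits at `P` are `N` and `N + 1` and the digits at `P + 1` are `1`, then the
logarithmic distance of the Gauss iterates at `P` is less than `1`. -/
lemma HasCF.abs_log_alphaIter_sub_lt_one {x y : ℝ} {d e : ℕ → ℕ} (hx : HasCF x d)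
    (hy : HasCF y e) {P N : ℕ} (hN : 0 < N) (hdP : d P = N) (heP : e P = N + 1)
    (hd : d (P + 1) = 1) :
    |Real.log (alphaIter x P) - Real.log (alphaIter y P)| < 1 := by
  have hN' : (1 : ℝ) ≤ N := by exact_mod_cast hN
  rw [hx.log_alphaIter P, hy.log_alphaIter P, hdP, heP, neg_sub_neg]
  obtain ⟨hx0, hx1⟩ := hx.alphaIter_mem_Ioo (P + 1)
  obtain ⟨hy0, hy1⟩ := hy.alphaIter_mem_Ioo (P + 1)
  have hhalf : 1 / 2 < alphaIter x (P + 1) := by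
    have h1 := hx.one_div_alphaIter (P + 1)
    have h2 := (hx.alphaIter_mem_Ioo (P + 1 + 1)).2
    rw [hd, div_eq_iff hx0.ne'] at h1
    push_cast at h1
    nlinarith
  push_cast
  rw [abs_of_nonneg (sub_nonneg.2 (Real.log_le_log (by linarith) (by linarith)))]
  have hle : Real.log (N + 1 + alphaIter y (P + 1)) ≤
      Real.log (2 * (N + alphaIter x (P + 1))) :=
    Real.log_le_log (by linarith) (by linarith)
  rw [Real.log_mul (by norm_num) (by linarith)] at hle
  linarith [Real.log_two_lt_d9]

/-- Lemma `4lems` part 3: for `1 ≤ i < n+m`,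
`|log( log(1/α_i(β^N)) / log(1/α_i(β^{N+1})) )| < 2^{i-(n+m)+1}`. -/
theorem alpha_loglog_ratio_succ
    (n m : ℕ) (hm : 0 < m) (a : ℕ → ℕ) (ha : ∀ i < n, 0 < a i)
    (N : ℕ) (hN : 0 < N)
    (βN βN1 : ℝ)
    (hβN : HasCF βN (betaDigits n m N a))
    (hβN1 : HasCF βN1 (betaDigits n m (N + 1) a))
    (i : ℕ) (hi1 : 1 ≤ i) (hi2 : i < n + m) :
    |Real.log (Real.log (1 / alphaIter βN (i - 1)) / Real.log (1 / alphaIter βN1 (i - 1)))|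
      < (2 : ℝ) ^ ((i : ℤ) - (n + m) + 1) := by
  obtain ⟨k, rfl⟩ : ∃ k, i = k + 1 := ⟨i - 1, by omega⟩
  obtain ⟨j, hj⟩ : ∃ j, n + m = k + 1 + j + 1 := ⟨n + m - (k + 2), by omega⟩
  have hdig : ∀ l, l < k + 1 + j → 0 < betaDigits n m N a l ∧
      betaDigits n m N a l = betaDigits n m (N + 1) a l := by
    intro l hl
    have hne : l + 1 ≠ n + m := by omega
    simp only [betaDigits, if_neg hne, and_true]
    split_ifs with hln
    · exact ha l hln
    · exact one_pos
  have hlast := hβN.abs_log_alphaIter_sub_lt_one hβN1 (P := k + 1 + j) hN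
    (by simp [betaDigits, hj]) (by simp [betaDigits, hj])
    (by simp [betaDigits, hj]; omega)
  have hcontr := hβN.abs_log_alphaIter_sub_le hβN1 (k + 1) j fun l _ hl => hdig l hl
  obtain ⟨hpos, heq⟩ := hdig k (by omega)
  have hfirst := abs_log_div_log_add_le (c := betaDigits n m N a k) (by exact_mod_cast hpos)
    (hβN.alphaIter_mem_Ioo (k + 1)).1 (hβN1.alphaIter_mem_Ioo (k + 1)).1
  have hexp : ((k + 1 : ℕ) : ℤ) - (n + m) + 1 = -(j : ℤ) := by omega
  rw [Nat.add_sub_cancel, hβN.one_div_alphaIter k, hβN1.one_div_alphaIter k, ← heq, hexp,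
    zpow_neg, zpow_natCast, ← one_div]
  exact (hfirst.trans hcontr).trans_lt (div_lt_div_of_pos_right hlast (by positivity))
end

section
/- Fix a finite sequence of positive integers (a_1,…,a_n). For every ε > 0 there exists an integer m_0 > 0 such that for every m ≥ m_0 and every positive integer N, one has |Φ⁻(β^N) − Φ⁻(β^1)| < ε/4, where Φ⁻(γ) = Φ(γ) − α_1(γ)α_2(γ)⋯α_{n+m−1}(γ)·log(1/α_{n+m}(γ)) is the Brjuno sum with its (n+m)-th term removed. -/
open scoped Real ENNReal
open Filter

/-- The Brjuno sum with its `(n+m)`-th term removed: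
`Φ⁻(γ) = Φ(γ) - α_1(γ)⋯α_{n+m-1}(γ)·log(1/α_{n+m}(γ))`. -/
noncomputable def brjunoPhiMinus (n m : ℕ) (γ : ℝ) : ℝ :=
  brjunoPhi γ -
    (∏ j ∈ Finset.range (n + m - 1), alphaIter γ j) * Real.log (1 / alphaIter γ (n + m - 1))

open Topology

namespace HasCF

variable {x y : ℝ} {d e : ℕ → ℕ}

lemma alphaIter_mem (h : HasCF x d) (k : ℕ) :
    alphaIter x k ∈ Set.Ioo (0 : ℝ) 1 ∧ Irrational (alphaIter x k) := by
  induction k with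
  | zero => exact ⟨h.1, h.2.1⟩
  | succ k ih =>
    have hirr : Irrational (alphaIter x (k + 1)) := by
      have h1 : Irrational (1 / alphaIter x k) := by
        rw [one_div]
        exact ih.2.inv
      exact h1.sub_intCast ⌊1 / alphaIter x k⌋
    exact ⟨⟨lt_of_le_of_ne (Int.fract_nonneg _) hirr.ne_zero.symm, Int.fract_lt_one _⟩, hirr⟩

lemma alphaIter_pos (h : HasCF x d) (k : ℕ) : 0 < alphaIter x k := (h.alphaIter_mem k).1.1

lemma alphaIter_lt_one (h : HasCF x d) (k : ℕ) : alphaIter x k < 1 := (h.alphaIter_mem k).1.2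

lemma one_div_alphaIter_s6 (h : HasCF x d) (k : ℕ) :
    1 / alphaIter x k = d k + alphaIter x (k + 1) := by
  have h1 := Int.floor_add_fract (1 / alphaIter x k)
  rw [h.2.2 k] at h1
  exact_mod_cast h1.symm

lemma alphaIter_mul (h : HasCF x d) (k : ℕ) :
    alphaIter x k * (d k + alphaIter x (k + 1)) = 1 := by
  rw [← h.one_div_alphaIter_s6 k, mul_one_div_cancel (h.alphaIter_pos k).ne']

lemma one_le_digit (h : HasCF x d) (k : ℕ) : (1 : ℝ) ≤ d k := by
  have h1 : d k ≠ 0 := fun h0 => by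
    have h2 := h.alphaIter_mul k
    rw [h0, Nat.cast_zero, zero_add] at h2
    nlinarith [h.alphaIter_pos k, h.alphaIter_lt_one k, h.alphaIter_pos (k + 1),
      h.alphaIter_lt_one (k + 1)]
  exact_mod_cast Nat.one_le_iff_ne_zero.mpr h1

lemma alphaIter_mul_succ_le (h : HasCF x d) (k : ℕ) :
    alphaIter x k * alphaIter x (k + 1) ≤ 1 / 2 := by
  have h1 := h.alphaIter_mul k
  have h2 := mul_le_mul_of_nonneg_left (h.one_le_digit k) (h.alphaIter_pos k).le
  have h3 := mul_le_mul_of_nonneg_left (h.alphaIter_lt_one (k + 1)).le (h.alphaIter_pos k).le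
  linarith

lemma prod_alphaIter_nonneg (h : HasCF x d) (k : ℕ) :
    0 ≤ ∏ j ∈ Finset.range k, alphaIter x j :=
  Finset.prod_nonneg fun j _ => (h.alphaIter_pos j).le

lemma prod_alphaIter_le_one (h : HasCF x d) (k : ℕ) :
    ∏ j ∈ Finset.range k, alphaIter x j ≤ 1 :=
  Finset.prod_le_one (fun j _ => (h.alphaIter_pos j).le) fun j _ => (h.alphaIter_lt_one j).le

lemma prod_alphaIter_le (h : HasCF x d) (k : ℕ) :
    ∏ j ∈ Finset.range k, alphaIter x j ≤ 2 * (3 / 4 : ℝ) ^ k := by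
  induction k using Nat.twoStepInduction with
  | zero => norm_num
  | one => simpa using (h.alphaIter_lt_one 0).le.trans (by norm_num)
  | more k ih _ =>
    rw [Finset.prod_range_succ, Finset.prod_range_succ, mul_assoc]
    calc _ ≤ (2 * (3 / 4 : ℝ) ^ k) * (1 / 2) :=
          mul_le_mul ih (h.alphaIter_mul_succ_le k)
            (mul_nonneg (h.alphaIter_pos _).le (h.alphaIter_pos _).le) (by positivity)
      _ ≤ 2 * (3 / 4 : ℝ) ^ (k + 2) := by
          rw [pow_add]
          have : (0 : ℝ) < (3 / 4) ^ k := by positivity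
          linarith

lemma abs_alphaIter_sub_eq (hx : HasCF x d) (hy : HasCF y e) {j : ℕ} (hj : d j = e j) :
    |alphaIter x j - alphaIter y j| =
      alphaIter x j * alphaIter y j * |alphaIter x (j + 1) - alphaIter y (j + 1)| := by
  have h1 := hx.alphaIter_mul j
  have h2 := hy.alphaIter_mul j
  rw [← hj] at h2
  have h3 : alphaIter x j - alphaIter y j =
      -(alphaIter x j * alphaIter y j * (alphaIter x (j + 1) - alphaIter y (j + 1))) := by
    linear_combination alphaIter y j * h1 - alphaIter x j * h2
  rw [h3, abs_neg, abs_mul, abs_of_pos (mul_pos (hx.alphaIter_pos j) (hy.alphaIter_pos j))]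

lemma abs_alphaIter_sub_le_one (hx : HasCF x d) (hy : HasCF y e) (j : ℕ) :
    |alphaIter x j - alphaIter y j| ≤ 1 := by
  rw [abs_le]
  constructor <;>
    linarith [hx.alphaIter_pos j, hy.alphaIter_pos j, hx.alphaIter_lt_one j, hy.alphaIter_lt_one j]

lemma abs_alphaIter_sub_le (hx : HasCF x d) (hy : HasCF y e) (i j : ℕ)
    (hde : ∀ l, j ≤ l → l < j + i → d l = e l) :
    |alphaIter x j - alphaIter y j| ≤ 2 * (1 / 2 : ℝ) ^ i := by
  induction i using Nat.twoStepInduction generalizing j with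
  | zero => linarith [hx.abs_alphaIter_sub_le_one hy j, pow_zero (1 / 2 : ℝ)]
  | one => linarith [hx.abs_alphaIter_sub_le_one hy j, pow_one (1 / 2 : ℝ)]
  | more i ih _ =>
    rw [hx.abs_alphaIter_sub_eq hy (hde j le_rfl (by omega)),
      hx.abs_alphaIter_sub_eq hy (hde (j + 1) (by omega) (by omega))]
    have h1 := ih (j + 2) fun l hl hl' => hde l (by omega) (by omega)
    have hq : (alphaIter x j * alphaIter x (j + 1)) * (alphaIter y j * alphaIter y (j + 1))
        ≤ (1 / 2) * (1 / 2) :=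
      mul_le_mul (hx.alphaIter_mul_succ_le j) (hy.alphaIter_mul_succ_le j)
        (mul_nonneg (hy.alphaIter_pos _).le (hy.alphaIter_pos _).le) (by norm_num)
    calc _ = ((alphaIter x j * alphaIter x (j + 1)) * (alphaIter y j * alphaIter y (j + 1))) *
          |alphaIter x (j + 2) - alphaIter y (j + 2)| := by ring
      _ ≤ ((1 / 2) * (1 / 2)) * (2 * (1 / 2 : ℝ) ^ i) :=
          mul_le_mul hq h1 (abs_nonneg _) (by norm_num)
      _ = 2 * (1 / 2 : ℝ) ^ (i + 2) := by ring

lemma abs_prod_alphaIter_sub_le (hx : HasCF x d) (hy : HasCF y e) {δ : ℝ} (k : ℕ)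
    (hδ : ∀ j < k, |alphaIter x j - alphaIter y j| ≤ δ) :
    |∏ j ∈ Finset.range k, alphaIter x j - ∏ j ∈ Finset.range k, alphaIter y j| ≤ k * δ := by
  induction k with
  | zero => simp
  | succ k ih =>
    have h1 := ih fun j hj => hδ j (by omega)
    have h2 := hδ k (by omega)
    rw [Finset.prod_range_succ, Finset.prod_range_succ]
    set p := ∏ j ∈ Finset.range k, alphaIter x j
    set q := ∏ j ∈ Finset.range k, alphaIter y j
    have hp : |p| ≤ 1 := by
      rw [abs_of_nonneg (hx.prod_alphaIter_nonneg k)]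
      exact hx.prod_alphaIter_le_one k
    have hyk : |alphaIter y k| ≤ 1 := by
      rw [abs_of_pos (hy.alphaIter_pos k)]
      exact (hy.alphaIter_lt_one k).le
    calc |p * alphaIter x k - q * alphaIter y k|
        = |p * (alphaIter x k - alphaIter y k) + (p - q) * alphaIter y k| := by ring_nf
      _ ≤ |p| * |alphaIter x k - alphaIter y k| + |p - q| * |alphaIter y k| := by
          rw [← abs_mul, ← abs_mul]
          exact abs_add_le _ _
      _ ≤ 1 * δ + k * δ * 1 := by
          gcongr
          exact (abs_nonneg _).trans h1
      _ = _ := by push_cast; ring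

lemma log_one_div_nonneg (h : HasCF x d) (k : ℕ) : 0 ≤ Real.log (1 / alphaIter x k) :=
  Real.log_nonneg (by
    rw [le_div_iff₀ (h.alphaIter_pos k), one_mul]
    exact (h.alphaIter_lt_one k).le)

lemma one_div_alphaIter_le (h : HasCF x d) {B : ℝ} {k : ℕ} (hB : (d k : ℝ) ≤ B) :
    1 / alphaIter x k ≤ B + 1 := by
  rw [h.one_div_alphaIter_s6]
  linarith [h.alphaIter_lt_one (k + 1)]

lemma log_one_div_le (h : HasCF x d) {B : ℝ} {k : ℕ} (hB : (d k : ℝ) ≤ B) :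
    Real.log (1 / alphaIter x k) ≤ B := by
  linarith [Real.log_le_sub_one_of_pos (one_div_pos.mpr (h.alphaIter_pos k)),
    h.one_div_alphaIter_le hB]

lemma log_one_div_sub_le (hx : HasCF x d) (hy : HasCF y e) {B : ℝ} {k : ℕ}
    (hB : (d k : ℝ) ≤ B) :
    Real.log (1 / alphaIter x k) - Real.log (1 / alphaIter y k) ≤
      (B + 1) * |alphaIter x k - alphaIter y k| := by
  have h0 := hx.alphaIter_pos k
  have h0' := hy.alphaIter_pos k
  have h1 := Real.log_le_sub_one_of_pos (div_pos h0' h0)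
  have h2 : Real.log (1 / alphaIter x k) - Real.log (1 / alphaIter y k) =
      Real.log (alphaIter y k / alphaIter x k) := by
    rw [one_div, one_div, Real.log_inv, Real.log_inv, Real.log_div h0'.ne' h0.ne']
    ring
  calc _ ≤ alphaIter y k / alphaIter x k - 1 := h2 ▸ h1
    _ = 1 / alphaIter x k * (alphaIter y k - alphaIter x k) := by field_simp
    _ ≤ 1 / alphaIter x k * |alphaIter x k - alphaIter y k| := by
        gcongr
        rw [abs_sub_comm]
        exact le_abs_self _
    _ ≤ _ := by
        gcongr
        exact hx.one_div_alphaIter_le hB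

lemma abs_log_one_div_sub_le (hx : HasCF x d) (hy : HasCF y e) {B : ℝ} {k : ℕ}
    (hB : (d k : ℝ) ≤ B) (hB' : (e k : ℝ) ≤ B) :
    |Real.log (1 / alphaIter x k) - Real.log (1 / alphaIter y k)| ≤
      (B + 1) * |alphaIter x k - alphaIter y k| := by
  rw [abs_le']
  refine ⟨hx.log_one_div_sub_le hy hB, ?_⟩
  rw [neg_sub, abs_sub_comm]
  exact hy.log_one_div_sub_le hx hB'

end HasCF

/-- The `k`-th (0-indexed) term of the series defining `brjunoPhi`. -/
noncomputable def brjunoTerm (θ : ℝ) (k : ℕ) : ℝ :=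
  (∏ j ∈ Finset.range k, alphaIter θ j) * Real.log (1 / alphaIter θ k)

namespace HasCF

variable {x y : ℝ} {d e : ℕ → ℕ} {B : ℝ}

lemma brjunoTerm_nonneg (h : HasCF x d) (k : ℕ) : 0 ≤ brjunoTerm x k :=
  mul_nonneg (h.prod_alphaIter_nonneg k) (h.log_one_div_nonneg k)

lemma brjunoTerm_le (h : HasCF x d) {k : ℕ} (hB : (d k : ℝ) ≤ B) :
    brjunoTerm x k ≤ 2 * (3 / 4 : ℝ) ^ k * B :=
  mul_le_mul (h.prod_alphaIter_le k) (h.log_one_div_le hB) (h.log_one_div_nonneg k)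
    (by positivity)

lemma abs_brjunoTerm_sub_le (hx : HasCF x d) (hy : HasCF y e) {k : ℕ} {δ : ℝ}
    (hB : (d k : ℝ) ≤ B) (hB' : (e k : ℝ) ≤ B)
    (hδ : ∀ j ≤ k, |alphaIter x j - alphaIter y j| ≤ δ) :
    |brjunoTerm x k - brjunoTerm y k| ≤ (k + 1) * (B + 1) * δ := by
  have h1 := hx.abs_prod_alphaIter_sub_le hy k fun j hj => hδ j hj.le
  have h2 := hx.abs_log_one_div_sub_le hy hB hB'
  have h3 := hδ k le_rfl
  have hδ0 : 0 ≤ δ := (abs_nonneg _).trans h3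
  have hB0 : 0 ≤ B := (Nat.cast_nonneg _).trans hB
  have hp := hx.prod_alphaIter_le_one k
  have hp0 := hx.prod_alphaIter_nonneg k
  have hl := hy.log_one_div_le hB'
  have hl0 := hy.log_one_div_nonneg k
  unfold brjunoTerm
  set p := ∏ j ∈ Finset.range k, alphaIter x j
  set q := ∏ j ∈ Finset.range k, alphaIter y j
  set u := Real.log (1 / alphaIter x k)
  set v := Real.log (1 / alphaIter y k)
  calc |p * u - q * v| = |p * (u - v) + (p - q) * v| := by ring_nf
    _ ≤ |p * (u - v)| + |(p - q) * v| := abs_add_le _ _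
    _ = p * |u - v| + |p - q| * v := by
        rw [abs_mul, abs_mul, abs_of_nonneg hp0, abs_of_nonneg hl0]
    _ ≤ 1 * ((B + 1) * δ) + k * δ * B := by
        gcongr
        exact h2.trans (by gcongr)
    _ ≤ (k + 1) * (B + 1) * δ := by
        have : 0 ≤ (k : ℝ) * δ := by positivity
        nlinarith

lemma summable_ite_brjunoTerm (h : HasCF x d) {K : ℕ} (hB : ∀ k, k ≠ K → (d k : ℝ) ≤ B) :
    Summable fun k => if k = K then 0 else brjunoTerm x k := by
  have hs : Summable fun k : ℕ => 2 * (3 / 4 : ℝ) ^ k * |B| :=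
    ((summable_geometric_of_lt_one (by norm_num) (by norm_num)).mul_left 2).mul_right _
  refine hs.of_nonneg_of_le (fun k => ?_) fun k => ?_
  · split_ifs
    exacts [le_rfl, h.brjunoTerm_nonneg k]
  · split_ifs with hk
    · positivity
    · exact (h.brjunoTerm_le (hB k hk)).trans (by gcongr; exact le_abs_self B)

lemma brjunoPhiMinus_eq_tsum (h : HasCF x d) (n m : ℕ)
    (hB : ∀ k, k ≠ n + m - 1 → (d k : ℝ) ≤ B) :
    brjunoPhiMinus n m x = ∑' k, if k = n + m - 1 then 0 else brjunoTerm x k := by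
  have hs : Summable (Function.update (brjunoTerm x) (n + m - 1) 0) :=
    (h.summable_ite_brjunoTerm hB).congr fun k => by simp [Function.update_apply]
  exact sub_eq_of_eq_add' (hs.tsum_eq_add_tsum_ite' (n + m - 1))

end HasCF

/-- A summable bound, uniform in the position `K` of the exceptional digit, for the termwise
difference of two Brjuno series whose digits are bounded by `B` and agree away from `K`. -/
noncomputable def brjunoDiffBound (B : ℝ) (K k : ℕ) : ℝ :=
  min (2 * (3 / 4 : ℝ) ^ k * B) ((k + 1) * (B + 1) * (2 * (1 / 2 : ℝ) ^ (K - k)))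

lemma brjunoDiffBound_nonneg {B : ℝ} (hB : 0 ≤ B) (K k : ℕ) : 0 ≤ brjunoDiffBound B K k :=
  le_min (by positivity) (by positivity)

lemma summable_brjunoDiffBound {B : ℝ} (hB : 0 ≤ B) (K : ℕ) :
    Summable (brjunoDiffBound B K) :=
  (((summable_geometric_of_lt_one (by norm_num) (by norm_num)).mul_left 2).mul_right
    B).of_nonneg_of_le (brjunoDiffBound_nonneg hB K) fun _ => min_le_left _ _

lemma tendsto_tsum_brjunoDiffBound {B : ℝ} (hB : 0 ≤ B) :
    Tendsto (fun K => ∑' k, brjunoDiffBound B K k) atTop (𝓝 0) := by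
  have hs : Summable fun k : ℕ => 2 * (3 / 4 : ℝ) ^ k * B :=
    ((summable_geometric_of_lt_one (by norm_num) (by norm_num)).mul_left 2).mul_right _
  rw [← tsum_zero (α := ℝ) (β := ℕ)]
  refine tendsto_tsum_of_dominated_convergence hs (fun k => ?_) (Eventually.of_forall fun K k => ?_)
  · have h1 : Tendsto (fun K : ℕ => (1 / 2 : ℝ) ^ (K - k)) atTop (𝓝 0) :=
      (tendsto_pow_atTop_nhds_zero_of_lt_one (by norm_num) (by norm_num)).comp
        (tendsto_sub_atTop_nat k)
    have h2 := (h1.const_mul 2).const_mul (((k : ℝ) + 1) * (B + 1))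
    rw [mul_zero, mul_zero] at h2
    exact squeeze_zero (fun K => brjunoDiffBound_nonneg hB K k) (fun K => min_le_right _ _) h2
  · rw [Real.norm_of_nonneg (brjunoDiffBound_nonneg hB K k)]
    exact min_le_left _ _

lemma HasCF.abs_brjunoPhiMinus_sub_le {x y B : ℝ} {d e : ℕ → ℕ} (hx : HasCF x d)
    (hy : HasCF y e) (n m : ℕ) (hB : ∀ k, k ≠ n + m - 1 → (d k : ℝ) ≤ B)
    (hde : ∀ k, k ≠ n + m - 1 → d k = e k) :
    |brjunoPhiMinus n m x - brjunoPhiMinus n m y| ≤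
      ∑' k, brjunoDiffBound B (n + m - 1) k := by
  have hB' : ∀ k, k ≠ n + m - 1 → (e k : ℝ) ≤ B := fun k hk => hde k hk ▸ hB k hk
  have hB0 : 0 ≤ B := (Nat.cast_nonneg _).trans (hB (n + m - 1 + 1) (by omega))
  rw [hx.brjunoPhiMinus_eq_tsum n m hB, hy.brjunoPhiMinus_eq_tsum n m hB',
    ← (hx.summable_ite_brjunoTerm hB).tsum_sub (hy.summable_ite_brjunoTerm hB'),
    ← Real.norm_eq_abs]
  refine tsum_of_norm_bounded (summable_brjunoDiffBound hB0 _).hasSum fun k => ?_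
  by_cases hk : k = n + m - 1
  · simpa [hk] using brjunoDiffBound_nonneg hB0 (n + m - 1) (n + m - 1)
  · rw [if_neg hk, if_neg hk, Real.norm_eq_abs]
    refine le_min ?_ (hx.abs_brjunoTerm_sub_le hy (hB k hk) (hB' k hk) fun j hj => ?_)
    · rw [abs_le]
      constructor <;>
        linarith [hx.brjunoTerm_nonneg k, hy.brjunoTerm_nonneg k, hx.brjunoTerm_le (hB k hk),
          hy.brjunoTerm_le (hB' k hk)]
    · exact hx.abs_alphaIter_sub_le hy _ j fun l hl hl' => hde l (by omega)

lemma betaDigits_of_ne {n m k : ℕ} (N : ℕ) (a : ℕ → ℕ) (hm : 0 < m) (hk : k ≠ n + m - 1) :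
    betaDigits n m N a k = nobleDigits n a k :=
  if_neg (by omega)

lemma nobleDigits_le (n : ℕ) (a : ℕ → ℕ) (k : ℕ) :
    nobleDigits n a k ≤ 1 + ∑ i ∈ Finset.range n, a i := by
  unfold nobleDigits
  split_ifs with hk
  · exact (Finset.single_le_sum (fun i _ => Nat.zero_le (a i)) (Finset.mem_range.mpr hk)).trans
      (Nat.le_add_left _ _)
  · exact Nat.le_add_right _ _

/-- Lemma `lem5`: for `m` large enough, `|Φ⁻(β^N) - Φ⁻(β^1)| < ε/4` for all `N`. -/
theorem phiMinus_close_to_one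
    (n : ℕ) (a : ℕ → ℕ) (ha : ∀ i < n, 0 < a i)
    (ε : ℝ) (hε : 0 < ε) :
    ∃ m₀ : ℕ, 0 < m₀ ∧ ∀ m ≥ m₀, ∀ N : ℕ, 0 < N →
      ∀ βN β1 : ℝ,
        HasCF βN (betaDigits n m N a) →
        HasCF β1 (betaDigits n m 1 a) →
        |brjunoPhiMinus n m βN - brjunoPhiMinus n m β1| < ε / 4 := by
  have hlim := (tendsto_tsum_brjunoDiffBound
    (Nat.cast_nonneg (α := ℝ) (1 + ∑ i ∈ Finset.range n, a i))).eventually_lt_const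
      (show (0 : ℝ) < ε / 4 by positivity)
  obtain ⟨K₀, hK₀⟩ := eventually_atTop.mp hlim
  refine ⟨K₀ + 1, by omega, fun m hm N _ βN β1 hN h1 => ?_⟩
  refine (hN.abs_brjunoPhiMinus_sub_le h1 n m (fun k hk => ?_) fun k hk => ?_).trans_lt
    (hK₀ (n + m - 1) (by omega))
  · rw [betaDigits_of_ne N a (by omega) hk]
    exact_mod_cast nobleDigits_le n a k
  · rw [betaDigits_of_ne N a (by omega) hk, betaDigits_of_ne 1 a (by omega) hk]
end
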